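/- Depth-2 case of the explicit parity formula with i=0: for positive integers k₁, k₂ with k₂ ≥ 2 and k₁+k₂ odd, ζ(k₁,k₂) = (ζ(k₁,k₂) − ζ(k₁,k₂) − ζ(k₁+k₂))/2 − ∑_{0≤i<j≤2} ∑_{a+2m+b=k_j} (-1)^{m+i+b+k₁+⋯+k_j} (2π)^{2m} B_{2m}/(2(2m)!) ζ^{⋆,*}(k₁,…,k_i) ζ_a^*(…) ζ_b(…), which expresses ζ(k₁,k₂) as −ζ(k₁+k₂)/2 plus an explicit ℚ-linear combination of terms ζ(odd)·π^{even} and ζ(p)ζ(q) type products of total weight k₁+k₂. -/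

import Mathlib

open scoped BigOperators
open Real

/-- The multiple zeta value `ζ(k₁,…,k_d) = ∑_{0<m₁<⋯<m_d} ∏ 1/m_i^{k_i}`
(as a `tsum` over strictly increasing tuples of positive integers). -/
noncomputable def MZV (k : List ℕ) : ℝ :=
  ∑' m : {f : Fin k.length → ℕ+ // StrictMono f}, ∏ i, 1 / ((m.1 i : ℕ) : ℝ) ^ k.get i

/-- The stuffle (quasi-shuffle) product of two words, as a multiset of words. -/
def stuffle : List ℕ → List ℕ → Multiset (List ℕ)
  | [], v => {v}
  | u, [] => {u}
  | a :: u, b :: v =>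
      (stuffle u (b :: v)).map (a :: ·) + (stuffle (a :: u) v).map (b :: ·) +
        (stuffle u v).map ((a + b) :: ·)
  termination_by u v => u.length + v.length

/-- All contractions of a word: the results of replacing each comma by `,` or `+`. -/
def contractions : List ℕ → Multiset (List ℕ)
  | [] => {[]}
  | [a] => {[a]}
  | a :: b :: t => (contractions (b :: t)).map (a :: ·) + contractions ((a + b) :: t)
  termination_by l => l.length

/-- `Z` is a stuffle (harmonic) regularization of multiple zeta values:
it takes the value `1` on the empty word, agrees with the convergent multiple zeta
values on admissible words, and is a homomorphism for the stuffle product. -/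
structure IsStuffleReg (Z : List ℕ → ℝ) : Prop where
  empty : Z [] = 1
  conv : ∀ l : List ℕ, (∀ i ∈ l, 0 < i) → 2 ≤ l.getLastD 2 → Z l = MZV l
  mul : ∀ u v : List ℕ, (∀ i ∈ u, 0 < i) → (∀ i ∈ v, 0 < i) →
    Z u * Z v = ((stuffle u v).map Z).sum

/-- The star version `ζ^{⋆,*}(k₁,…,k_d)`: the sum of `Z` over all contractions. -/
noncomputable def zetaStarOf (Z : List ℕ → ℝ) (l : List ℕ) : ℝ :=
  ((contractions l).map Z).sum

/-- `ζ_a^*(l₁,…,l_r) = (-1)^a ∑_{a₁+⋯+a_r=a} ζ^*(l₁+a₁,…,l_r+a_r) ∏ C(l_i-1+a_i,a_i)`. -/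
noncomputable def zetaA (Z : List ℕ → ℝ) (a : ℕ) (l : List ℕ) : ℝ :=
  (-1 : ℝ) ^ a *
    ∑ f ∈ (Fintype.piFinset fun _ : Fin l.length => Finset.range (a + 1)).filter
        (fun f => ∑ i, f i = a),
      Z (List.ofFn fun i => l.get i + f i) *
        ∏ i, (Nat.choose (l.get i - 1 + f i) (f i) : ℝ)

/-- `δ^{k₁,…,k_d}`: equal to `(-1)^n π^{2n}/(2n)!` if `(k₁,…,k_d) = (1,…,1)` has even
length `2n`, and `0` otherwise. -/
noncomputable def deltaVal (l : List ℕ) : ℝ :=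
  if l.all (· = 1) ∧ l.length % 2 = 0 then
    (-1 : ℝ) ^ (l.length / 2) * π ^ l.length / (Nat.factorial l.length) else 0

/-- The Riemann zeta value `∑ 1/n^k` as a sum over positive integers. -/
noncomputable def zetaPNat (k : ℕ) : ℝ := ∑' n : ℕ+, ((n : ℝ)⁻¹) ^ k

/-- The summand of the double zeta value, indexed by the smaller integer and the gap. -/
noncomputable def doubleZetaTerm (a b : ℕ) (x : ℕ+ × ℕ+) : ℝ :=
  ((x.1 : ℝ)⁻¹) ^ a * (((x.1 : ℝ) + x.2)⁻¹) ^ b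

/-- The double zeta value `∑_{m < n} m^{-a} n^{-b}`. -/
noncomputable def doubleZeta (a b : ℕ) : ℝ := ∑' x, doubleZetaTerm a b x

lemma hasSum_pnat_iff_of_zero {f : ℕ → ℝ} (hf : f 0 = 0) {s : ℝ} :
    HasSum (fun n : ℕ+ => f n) s ↔ HasSum f s := by
  refine PNat.coe_injective.hasSum_iff (f := f) fun x hx => ?_
  rcases Nat.eq_zero_or_pos x with rfl | h
  · exact hf
  · exact absurd ⟨⟨x, h⟩, rfl⟩ hx

lemma hasSum_zetaPNat {k : ℕ} (hk : 2 ≤ k) :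
    HasSum (fun n : ℕ+ => ((n : ℝ)⁻¹) ^ k) (zetaPNat k) := by
  have h : Summable (fun n : ℕ => ((n : ℝ)⁻¹) ^ k) := by
    simpa using (Real.summable_nat_pow_inv (p := k)).2 hk
  exact ((hasSum_pnat_iff_of_zero (by simp; omega)).2 h.hasSum).summable.hasSum

lemma zetaPNat_two_mul {m : ℕ} (hm : m ≠ 0) :
    (-1 : ℝ) ^ m * ((2 * π) ^ (2 * m) * ((bernoulli (2 * m) : ℚ) : ℝ) /
      (2 * Nat.factorial (2 * m))) = -zetaPNat (2 * m) := by
  have h := hasSum_zeta_nat hm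
  have h2 := ((hasSum_pnat_iff_of_zero (by simp [hm])).2 h).unique
    (by simpa using hasSum_zetaPNat (k := 2 * m) (by omega))
  rw [← h2]
  have : (2 : ℝ) ^ (2 * m) = 2 * 2 ^ (2 * m - 1) := by
    rw [← pow_succ']; congr 1; omega
  rw [mul_pow, this, pow_succ]
  field_simp

lemma summable_doubleZetaTerm {a b : ℕ} (ha : 1 ≤ a) (hb : 2 ≤ b) :
    Summable (doubleZetaTerm a b) := by
  have h0 : Summable (fun n : ℕ+ => 1 / ((n : ℕ) : ℝ) ^ (3 / 2 : ℝ)) :=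
    (Real.summable_one_div_nat_rpow.2 (by norm_num)).comp_injective PNat.coe_injective
  refine (h0.mul_of_nonneg h0 (fun _ => by positivity) (fun _ => by positivity)).of_nonneg_of_le
    (fun x => by unfold doubleZetaTerm; positivity) fun x => ?_
  obtain ⟨p, q⟩ := x
  have hp : (1 : ℝ) ≤ p := by exact_mod_cast p.pos
  have hq : (1 : ℝ) ≤ q := by exact_mod_cast q.pos
  simp only [doubleZetaTerm, inv_pow]
  rw [one_div_mul_one_div, ← mul_inv, ← one_div]
  refine one_div_le_one_div_of_le (by positivity) ?_
  have e1 : (p : ℝ) ^ (3 / 2 : ℝ) = p * (p : ℝ) ^ (1 / 2 : ℝ) := by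
    rw [← Real.rpow_one_add' (by positivity) (by norm_num)]; norm_num
  have e2 : ((p : ℝ) + q) ^ (1 / 2 : ℝ) * ((p : ℝ) + q) ^ (3 / 2 : ℝ) = (p + q) ^ 2 := by
    rw [← Real.rpow_add (by positivity), ← Real.rpow_natCast]; norm_num
  calc (p : ℝ) ^ (3 / 2 : ℝ) * (q : ℝ) ^ (3 / 2 : ℝ)
      = p * ((p : ℝ) ^ (1 / 2 : ℝ) * (q : ℝ) ^ (3 / 2 : ℝ)) := by rw [e1]; ring
    _ ≤ p * (((p : ℝ) + q) ^ (1 / 2 : ℝ) * ((p : ℝ) + q) ^ (3 / 2 : ℝ)) := by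
        gcongr <;> linarith
    _ = (p : ℝ) ^ 1 * (p + q) ^ 2 := by rw [e2, pow_one]
    _ ≤ (p : ℝ) ^ a * (p + q) ^ b :=
        mul_le_mul (pow_le_pow_right₀ hp ha) (pow_le_pow_right₀ (by linarith) hb)
          (by positivity) (by positivity)

lemma hasSum_doubleZeta {a b : ℕ} (ha : 1 ≤ a) (hb : 2 ≤ b) :
    HasSum (doubleZetaTerm a b) (doubleZeta a b) :=
  (summable_doubleZetaTerm ha hb).hasSum

/-- Splitting a sum over pairs of positive integers into the parts above, below and on the
diagonal. -/
lemma HasSum.of_trichotomy {f : ℕ+ × ℕ+ → ℝ} {s t u : ℝ}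
    (hs : HasSum (fun x : ℕ+ × ℕ+ => f (x.1, x.1 + x.2)) s)
    (ht : HasSum (fun x : ℕ+ × ℕ+ => f (x.1 + x.2, x.1)) t)
    (hu : HasSum (fun p : ℕ+ => f (p, p)) u) : HasSum f (s + (t + u)) := by
  let e : (ℕ+ × ℕ+) ⊕ ((ℕ+ × ℕ+) ⊕ ℕ+) → ℕ+ × ℕ+ :=
    Sum.elim (fun x => (x.1, x.1 + x.2)) (Sum.elim (fun x => (x.1 + x.2, x.1)) fun p => (p, p))
  have he : Function.Bijective e := by
    constructor
    · rintro (⟨a, b⟩ | ⟨a, b⟩ | a) (⟨c, d⟩ | ⟨c, d⟩ | c) h <;>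
        simp only [e, Sum.elim_inl, Sum.elim_inr, Prod.mk.injEq, ← PNat.coe_inj,
          PNat.add_coe] at h <;>
        have := a.pos <;> have := c.pos <;> (try have := b.pos) <;> (try have := d.pos) <;>
        simp only [Sum.inl.injEq, Sum.inr.injEq, Prod.mk.injEq, ← PNat.coe_inj,
          reduceCtorEq] <;> omega
    · rintro ⟨n, m⟩
      rcases lt_trichotomy n m with h | h | h
      · exact ⟨Sum.inl (n, m - n), by simp [e, PNat.add_sub_of_lt h]⟩
      · exact ⟨Sum.inr (Sum.inr n), by simp [e, h]⟩
      · exact ⟨Sum.inr (Sum.inl (m, n - m)), by simp [e, PNat.add_sub_of_lt h]⟩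
  rw [← (Equiv.ofBijective e he).hasSum_iff]
  exact HasSum.sum hs (HasSum.sum ht hu)

lemma hasSum_sub_succ {u : ℕ → ℝ} (hu : Antitone u) (h0 : Filter.Tendsto u Filter.atTop (nhds 0)) :
    HasSum (fun n => u n - u (n + 1)) (u 0) := by
  rw [hasSum_iff_tendsto_nat_of_nonneg (fun n => sub_nonneg.2 (hu n.le_succ))]
  simp only [Finset.sum_range_sub']
  simpa using h0.const_sub (u 0)

lemma hasSum_inv_add_sub_inv_succ (m : ℕ) :
    HasSum (fun n : ℕ => ((n : ℝ) + 1 + m)⁻¹ - ((n : ℝ) + 1 + (m + 1 : ℕ))⁻¹) ((m : ℝ) + 1)⁻¹ := by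
  have h := hasSum_sub_succ (u := fun n : ℕ => ((n : ℝ) + 1 + m)⁻¹)
    (fun i j hij => by dsimp only; gcongr)
    ((Filter.tendsto_atTop_add_const_right _ _ (Filter.tendsto_atTop_add_const_right _ _
      tendsto_natCast_atTop_atTop)).inv_tendsto_atTop)
  convert! h using 1
  · ext n; push_cast; ring
  · push_cast; ring

lemma hasSum_int_inv_succ_sub_inv :
    HasSum (fun k : ℤ => ((k : ℝ) + 1)⁻¹ - (k : ℝ)⁻¹) 0 := by
  have h : HasSum (fun n : ℕ => ((n : ℝ) + 1)⁻¹ - (n : ℝ)⁻¹) 0 := by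
    rw [← hasSum_nat_add_iff' 1]
    convert! (hasSum_inv_add_sub_inv_succ 0).neg using 1
    · ext n; push_cast; ring
    · simp
  have h' : HasSum (fun n : ℕ => (((-(n + 1 : ℤ) : ℤ) : ℝ) + 1)⁻¹ - ((-(n + 1 : ℤ) : ℤ) : ℝ)⁻¹) 0 := by
    convert! h using 1
    ext n
    push_cast
    rw [show (-((n : ℝ) + 1) + 1) = -n by ring, inv_neg, inv_neg]
    ring
  simpa using HasSum.of_nat_of_neg_add_one (f := fun k : ℤ => ((k : ℝ) + 1)⁻¹ - (k : ℝ)⁻¹)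
    (by simpa using h) h'


lemma hasSum_int_inv_add_inv_sub (n : ℕ) :
    HasSum (fun m : ℤ => (m : ℝ)⁻¹ + ((n : ℝ) - m)⁻¹) 0 := by
  induction n with
  | zero =>
    convert! hasSum_zero (α := ℝ) (β := ℤ) using 1
    ext m
    rw [Nat.cast_zero, zero_sub, inv_neg, add_neg_cancel]
  | succ n ih =>
    have h := (Equiv.subLeft (n : ℤ)).hasSum_iff.2 hasSum_int_inv_succ_sub_inv
    convert! ih.add h using 1
    · ext m
      simp only [Function.comp_apply, Equiv.subLeft_apply]
      push_cast
      rw [show (n : ℝ) + 1 - m = n - m + 1 by ring]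
      ring
    · simp

/-- The symmetric power sum `∑_{m ≠ 0} 1/m^i`, normalised to be zero for odd `i`. -/
noncomputable def zetaInt (i : ℕ) : ℝ := if Even i then 2 * zetaPNat i else 0

lemma hasSum_zetaInt {i : ℕ} (hi : 2 ≤ i) :
    HasSum (fun m : ℤ => ((m : ℝ)⁻¹) ^ i) (zetaInt i) := by
  have h0 : (((0 : ℕ) : ℝ)⁻¹) ^ i = 0 := by simp; omega
  have h := (hasSum_pnat_iff_of_zero (f := fun n : ℕ => ((n : ℝ)⁻¹) ^ i) h0).1 (hasSum_zetaPNat hi)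
  have h' : HasSum (fun n : ℕ => (((-(n : ℤ) : ℤ) : ℝ)⁻¹) ^ i) ((-1) ^ i * zetaPNat i) := by
    convert! h.mul_left ((-1 : ℝ) ^ i) using 1
    ext n
    rw [← mul_pow]
    push_cast
    rw [inv_neg]; ring
  convert! HasSum.of_nat_of_neg (f := fun m : ℤ => ((m : ℝ)⁻¹) ^ i) (by simpa using h) h' using 1
  have : i ≠ 0 := by omega
  rcases Nat.even_or_odd i with he | ho
  · simp [zetaInt, he, he.neg_one_pow, this]; ring
  · simp [zetaInt, Nat.not_even_iff_odd.2 ho, ho.neg_one_pow, this]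

/-- Half of the partial fraction expansion of `X^a * Y^b` when `X * Y = M * (X + Y)`. -/
def partialFractionHalf {R : Type*} [CommSemiring R] (X M : R) (a b : ℕ) : R :=
  ∑ s ∈ Finset.range a, ((b + s - 1).choose s : R) * X ^ (a - s) * M ^ (b + s)

lemma partialFractionHalf_succ_succ {R : Type*} [CommSemiring R] (X M : R) (a b : ℕ) :
    partialFractionHalf X M (a + 1) (b + 1) =
      M * (partialFractionHalf X M a (b + 1) + partialFractionHalf X M (a + 1) b) := by
  unfold partialFractionHalf
  rw [mul_add, Finset.mul_sum, Finset.mul_sum, Finset.sum_range_succ' _ a,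
    Finset.sum_range_succ' _ a, ← add_assoc, ← Finset.sum_add_distrib]
  congr 1
  · refine Finset.sum_congr rfl fun s _ => ?_
    have h : (b + 1 + (s + 1) - 1).choose (s + 1) =
        (b + 1 + s - 1).choose s + (b + (s + 1) - 1).choose (s + 1) := by
      rw [show b + 1 + (s + 1) - 1 = (b + s) + 1 by omega, Nat.choose_succ_succ]
      congr 2; omega
    rw [h, show a + 1 - (s + 1) = a - s by omega]
    push_cast
    ring
  · simp; ring

lemma pow_mul_pow_eq_partialFraction {R : Type*} [CommRing R] {X Y M : R}
    (h : X * Y = M * (X + Y)) (a b : ℕ) (hab : 0 < a + b) :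
    X ^ a * Y ^ b = partialFractionHalf X M a b + partialFractionHalf Y M b a := by
  have base : ∀ (X Y : R) (b : ℕ), 0 < b →
      X ^ 0 * Y ^ b = partialFractionHalf X M 0 b + partialFractionHalf Y M b 0 := by
    intro X Y b hb
    obtain ⟨b, rfl⟩ := Nat.exists_eq_succ_of_ne_zero hb.ne'
    simp [partialFractionHalf, Finset.sum_range_succ']
  induction hn : a + b using Nat.strong_induction_on generalizing a b with
  | _ n ih =>
    rcases a with _ | a
    · exact base X Y b (by omega)
    rcases b with _ | b
    · rw [mul_comm, add_comm (partialFractionHalf _ _ _ _)]; exact base Y X (a + 1) (by omega)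
    · rw [partialFractionHalf_succ_succ, partialFractionHalf_succ_succ]
      have h1 := ih _ (by omega) a (b + 1) (by omega) rfl
      have h2 := ih _ (by omega) (a + 1) b (by omega) rfl
      linear_combination M * h1 + M * h2 + X ^ a * Y ^ b * h

lemma sum_range_choose_add (a b : ℕ) :
    ∑ s ∈ Finset.range (b + 1), (a + s).choose s = (a + 1 + b).choose b := by
  induction b with
  | zero => simp
  | succ b ih =>
    rw [Finset.sum_range_succ, ih, show a + 1 + (b + 1) = (a + 1 + b) + 1 by omega,
      Nat.choose_succ_succ, show a + (b + 1) = a + 1 + b by omega]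

lemma partialFractionHalf_self {R : Type*} [CommSemiring R] (M : R) (a b : ℕ) :
    partialFractionHalf M M (a + 1) (b + 1) =
      ((a + b + 1).choose a : R) * M ^ (a + b + 2) := by
  unfold partialFractionHalf
  rw [show a + b + 1 = b + 1 + a by omega, ← sum_range_choose_add, Nat.cast_sum, Finset.sum_mul]
  refine Finset.sum_congr rfl fun s hs => ?_
  rw [mul_assoc, ← pow_add]
  have := Finset.mem_range.1 hs
  rw [show b + 1 + s - 1 = b + s by omega]
  congr 2; omega


/-- The sum over `m` of `partialFractionHalf (1/m) M a b`, with the harmonic part removed. -/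
noncomputable def partialFractionSum (M : ℝ) (a b : ℕ) : ℝ :=
  ∑ s ∈ Finset.range a, ((b + s - 1).choose s : ℝ) * zetaInt (a - s) * M ^ (b + s)

lemma hasSum_partialFractionHalf_sub {x : ℤ → ℝ}
    (hx : ∀ i, 2 ≤ i → HasSum (fun m => x m ^ i) (zetaInt i)) (M : ℝ) (a b : ℕ) :
    HasSum (fun m => partialFractionHalf (x m) M (a + 1) (b + 1) -
      ((a + b).choose a : ℝ) * x m * M ^ (a + b + 1)) (partialFractionSum M (a + 1) (b + 1)) := by
  have hz : zetaInt 1 = 0 := by simp [zetaInt]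
  have h : HasSum (fun m => ∑ s ∈ Finset.range a,
      ((b + 1 + s - 1).choose s : ℝ) * x m ^ (a + 1 - s) * M ^ (b + 1 + s))
      (∑ s ∈ Finset.range a,
        ((b + 1 + s - 1).choose s : ℝ) * zetaInt (a + 1 - s) * M ^ (b + 1 + s)) :=
    hasSum_sum fun s hs => ((hx _ (by have := Finset.mem_range.1 hs; omega)).mul_left _).mul_right _
  convert! h using 1
  · ext m
    rw [partialFractionHalf, Finset.sum_range_succ, show b + 1 + a - 1 = a + b by omega,
      show a + 1 - a = 1 by omega, show b + 1 + a = a + b + 1 by omega, pow_one, add_sub_cancel_right]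
  · rw [partialFractionSum, Finset.sum_range_succ, show a + 1 - a = 1 by omega, hz]
    simp

lemma partialFractionHalf_zero {R : Type*} [CommSemiring R] (M : R) (a b : ℕ) :
    partialFractionHalf 0 M a b = 0 := by
  refine Finset.sum_eq_zero fun s hs => ?_
  have := Finset.mem_range.1 hs
  rw [zero_pow (by omega), mul_zero, zero_mul]

lemma hasSum_int_inv_pow_mul_inv_sub_pow (n : ℕ+) (a b : ℕ) :
    HasSum (fun m : ℤ => ((m : ℝ)⁻¹) ^ (a + 1) * (((n : ℝ) - m)⁻¹) ^ (b + 1))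
      (partialFractionSum (n : ℝ)⁻¹ (a + 1) (b + 1) + partialFractionSum (n : ℝ)⁻¹ (b + 1) (a + 1) -
        (((a + b + 1).choose a : ℝ) + (a + b + 1).choose b) * ((n : ℝ)⁻¹) ^ (a + b + 2)) := by
  have hn : (n : ℝ) ≠ 0 := by exact_mod_cast n.pos.ne'
  set M := (n : ℝ)⁻¹ with hM
  have hX := hasSum_partialFractionHalf_sub (x := fun m : ℤ => (m : ℝ)⁻¹)
    (fun i hi => hasSum_zetaInt hi) M a b
  have hY := hasSum_partialFractionHalf_sub (x := fun m : ℤ => ((n : ℝ) - m)⁻¹)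
    (fun i hi => by
      convert! (Equiv.subLeft ((n : ℕ) : ℤ)).hasSum_iff.2 (hasSum_zetaInt hi) using 1
      ext m; simp) M b a
  have hXY := (hasSum_int_inv_add_inv_sub n).mul_left (((a + b).choose a : ℝ) * M ^ (a + b + 1))
  have h0 := hasSum_ite_eq (0 : ℤ) (((a + b + 1).choose b : ℝ) * M ^ (a + b + 2))
  have hN := hasSum_ite_eq ((n : ℕ) : ℤ) (((a + b + 1).choose a : ℝ) * M ^ (a + b + 2))
  convert! (((hX.add hY).add hXY).sub h0).sub hN using 1
  · ext m
    have hc : (b + a).choose b = (a + b).choose a := by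
      rw [add_comm b a, Nat.choose_symm_add]
    by_cases hm0 : m = 0
    · subst hm0
      have hne : (0 : ℤ) ≠ ((n : ℕ) : ℤ) := by exact_mod_cast n.pos.ne
      rw [if_pos rfl, if_neg hne]
      simp only [Int.cast_zero, inv_zero, sub_zero, ← hM]
      rw [partialFractionHalf_zero, partialFractionHalf_self, hc, add_comm b a]
      ring
    by_cases hmn : m = ((n : ℕ) : ℤ)
    · subst hmn
      rw [if_neg hm0, if_pos rfl]
      simp only [Int.cast_natCast, sub_self, inv_zero, ← hM]
      rw [partialFractionHalf_zero, partialFractionHalf_self, hc]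
      ring
    · rw [if_neg hm0, if_neg hmn]
      have h1 : (m : ℝ) ≠ 0 := by exact_mod_cast hm0
      have h2 : (n : ℝ) - m ≠ 0 := by
        rw [sub_ne_zero]; exact_mod_cast Ne.symm hmn
      rw [pow_mul_pow_eq_partialFraction (M := M) (by rw [hM]; field_simp; ring) _ _ (by omega),
        hc, add_comm b a]
      ring
  · ring

lemma hasSum_pnat_inv_pow_mul_inv_sub_pow (n : ℕ+) (a b : ℕ) :
    HasSum (fun m : ℕ+ => ((m : ℝ)⁻¹) ^ (a + 1) * (((n : ℝ) - m)⁻¹) ^ (b + 1) +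
        (-1) ^ (a + 1) * (((m : ℝ)⁻¹) ^ (a + 1) * (((m : ℝ) + n)⁻¹) ^ (b + 1)))
      (partialFractionSum (n : ℝ)⁻¹ (a + 1) (b + 1) + partialFractionSum (n : ℝ)⁻¹ (b + 1) (a + 1) -
        (((a + b + 1).choose a : ℝ) + (a + b + 1).choose b) * ((n : ℝ)⁻¹) ^ (a + b + 2)) := by
  have h := (hasSum_int_inv_pow_mul_inv_sub_pow n a b).nat_add_neg
  rw [Int.cast_zero, inv_zero, zero_pow (Nat.succ_ne_zero a), zero_mul, add_zero] at h
  convert! (hasSum_pnat_iff_of_zero (by simp)).2 h using 1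
  ext m
  simp only [Int.cast_natCast, Int.cast_neg, sub_neg_eq_add, inv_neg, neg_pow (m : ℝ)⁻¹]
  rw [add_comm (m : ℝ) n]
  ring

lemma hasSum_partialFractionSum {a b : ℕ} (hb : 2 ≤ b) :
    HasSum (fun n : ℕ+ => partialFractionSum (n : ℝ)⁻¹ a b)
      (∑ s ∈ Finset.range a, ((b + s - 1).choose s : ℝ) * zetaInt (a - s) * zetaPNat (b + s)) :=
  hasSum_sum fun s _ => (hasSum_zetaPNat (by omega)).mul_left _

lemma HasSum.mul_prod_of_nonneg {ι κ : Type*} {f : ι → ℝ} {g : κ → ℝ} {s t : ℝ}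
    (hf : ∀ i, 0 ≤ f i) (hg : ∀ i, 0 ≤ g i) (hs : HasSum f s) (ht : HasSum g t) :
    HasSum (fun x : ι × κ => f x.1 * g x.2) (s * t) :=
  hs.mul ht (hs.summable.mul_of_nonneg ht.summable hf hg)

lemma doubleZeta_parity_relation {a b : ℕ} (ha : 1 ≤ a) (hb : 1 ≤ b) :
    (-1) ^ (a + 1) * doubleZeta (a + 1) (b + 1) + (-1) ^ (b + 1) * doubleZeta (b + 1) (a + 1) +
        zetaPNat (a + 1) * zetaPNat (b + 1) =
      ∑ s ∈ Finset.range (a + 1),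
          ((b + 1 + s - 1).choose s : ℝ) * zetaInt (a + 1 - s) * zetaPNat (b + 1 + s) +
        ∑ s ∈ Finset.range (b + 1),
          ((a + 1 + s - 1).choose s : ℝ) * zetaInt (b + 1 - s) * zetaPNat (a + 1 + s) -
        (((a + b + 1).choose a : ℝ) + (a + b + 1).choose b) * zetaPNat (a + b + 2) := by
  have hD := hasSum_doubleZeta (a := a + 1) (b := b + 1) (by omega) (by omega)
  have hD' := hasSum_doubleZeta (a := b + 1) (b := a + 1) (by omega) (by omega)
  have hP : HasSum (fun x : ℕ+ × ℕ+ => ((x.1 : ℝ)⁻¹) ^ (a + 1) * ((x.2 : ℝ)⁻¹) ^ (b + 1))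
      (zetaPNat (a + 1) * zetaPNat (b + 1)) := by
    have h1 := hasSum_zetaPNat (k := a + 1) (by omega)
    have h2 := hasSum_zetaPNat (k := b + 1) (by omega)
    exact HasSum.mul_prod_of_nonneg (f := fun n : ℕ+ => ((n : ℝ)⁻¹) ^ (a + 1))
      (g := fun n : ℕ+ => ((n : ℝ)⁻¹) ^ (b + 1)) (fun _ => by positivity)
      (fun _ => by positivity) h1 h2
  have hT : HasSum (fun x : ℕ+ × ℕ+ =>
      ((x.2 : ℝ)⁻¹) ^ (a + 1) * (((x.1 : ℝ) - x.2)⁻¹) ^ (b + 1))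
      ((-1) ^ (b + 1) * doubleZeta (b + 1) (a + 1) +
        (zetaPNat (a + 1) * zetaPNat (b + 1) + 0)) := by
    refine HasSum.of_trichotomy ?_ ?_ ?_
    · convert! (((Equiv.prodComm ℕ+ ℕ+).hasSum_iff.2 hD').mul_left ((-1) ^ (b + 1))) using 1
      ext ⟨p, q⟩
      simp only [doubleZetaTerm, Function.comp_apply, Equiv.prodComm_apply, Prod.swap_prod_mk,
        PNat.add_coe, Nat.cast_add]
      rw [show (p : ℝ) - (p + q) = -q by ring, inv_neg, neg_pow (q : ℝ)⁻¹, add_comm (q : ℝ)]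
      ring
    · convert! hP using 1
      ext ⟨p, q⟩
      simp
    · simp
  have hS : HasSum (fun x : ℕ+ × ℕ+ =>
      (-1) ^ (a + 1) * (((x.2 : ℝ)⁻¹) ^ (a + 1) * (((x.2 : ℝ) + x.1)⁻¹) ^ (b + 1)))
      ((-1) ^ (a + 1) * doubleZeta (a + 1) (b + 1)) :=
    ((Equiv.prodComm ℕ+ ℕ+).hasSum_iff.2 hD).mul_left _
  have h := (hT.add hS).prod_fiberwise fun n => hasSum_pnat_inv_pow_mul_inv_sub_pow n a b
  have h' := ((hasSum_partialFractionSum (a := a + 1) (b := b + 1) (by omega)).add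
    (hasSum_partialFractionSum (a := b + 1) (b := a + 1) (by omega))).sub
    ((hasSum_zetaPNat (k := a + b + 2) (by omega)).mul_left
      (((a + b + 1).choose a : ℝ) + (a + b + 1).choose b))
  rw [← h.unique h']
  ring


lemma doubleZeta_stuffle {a b : ℕ} (ha : 2 ≤ a) (hb : 2 ≤ b) :
    doubleZeta a b + doubleZeta b a + zetaPNat (a + b) = zetaPNat a * zetaPNat b := by
  have hP := HasSum.mul_prod_of_nonneg (f := fun n : ℕ+ => ((n : ℝ)⁻¹) ^ a)
    (g := fun n : ℕ+ => ((n : ℝ)⁻¹) ^ b) (fun _ => by positivity)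
    (fun _ => by positivity) (hasSum_zetaPNat ha) (hasSum_zetaPNat hb)
  rw [add_assoc]
  refine HasSum.unique (HasSum.of_trichotomy ?_ ?_ ?_) hP
  · convert! hasSum_doubleZeta (a := a) (by omega) hb using 1
    ext ⟨p, q⟩
    simp [doubleZetaTerm]
  · convert! hasSum_doubleZeta (a := b) (by omega) ha using 1
    ext ⟨p, q⟩
    simp [doubleZetaTerm, mul_comm]
  · convert! hasSum_zetaPNat (k := a + b) (by omega) using 1
    ext p
    rw [pow_add]

lemma hasSum_nat_inv_sub_inv_add (m : ℕ) :
    HasSum (fun n : ℕ => ((n : ℝ) + 1)⁻¹ - ((n : ℝ) + 1 + m)⁻¹)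
      (∑ j ∈ Finset.range m, ((j : ℝ) + 1)⁻¹) := by
  induction m with
  | zero => simp
  | succ m ih =>
    rw [Finset.sum_range_succ]
    convert! ih.add (hasSum_inv_add_sub_inv_succ m) using 1
    ext n
    ring

lemma hasSum_pnat_iff_succ {f : ℕ+ → ℝ} {s : ℝ} :
    HasSum f s ↔ HasSum (fun n : ℕ => f n.succPNat) s :=
  Equiv.pnatEquivNat.symm.hasSum_iff.symm

lemma sum_pow_mul_pow_add {R : Type*} [CommRing R] {x y u : R} (h : x * u = y * (x + u)) (c : ℕ) :
    ∑ i ∈ Finset.range c, x ^ (i + 1) * y ^ (c + 1 - i) + u * y ^ (c + 1) = x ^ c * (u * y) := by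
  induction c with
  | zero => simp
  | succ c ih =>
    have : ∑ i ∈ Finset.range c, x ^ (i + 1) * y ^ (c + 1 + 1 - i) =
        y * ∑ i ∈ Finset.range c, x ^ (i + 1) * y ^ (c + 1 - i) := by
      rw [Finset.mul_sum]
      refine Finset.sum_congr rfl fun i hi => ?_
      have := Finset.mem_range.1 hi
      rw [show c + 1 + 1 - i = (c + 1 - i) + 1 by omega]
      ring
    rw [Finset.sum_range_succ, this, show c + 1 + 1 - c = 2 by omega]
    linear_combination y * ih - x ^ c * y * h

/-- The sum formula for double zeta values. -/
lemma sum_doubleZeta (c : ℕ) (hc : 1 ≤ c) :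
    ∑ i ∈ Finset.range c, doubleZeta (i + 1) (c + 1 - i) = zetaPNat (c + 2) := by
  have hD := hasSum_doubleZeta (a := 1) (b := c + 1) le_rfl (by omega)
  have hA : HasSum (fun x : ℕ+ × ℕ+ =>
      ((x.1 : ℝ)⁻¹) ^ c * ((x.2 : ℝ)⁻¹ * ((x.1 : ℝ) + x.2)⁻¹))
      (∑ i ∈ Finset.range c, doubleZeta (i + 1) (c + 1 - i) + doubleZeta 1 (c + 1)) := by
    have hs : HasSum (fun x => ∑ i ∈ Finset.range c, doubleZetaTerm (i + 1) (c + 1 - i) x)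
        (∑ i ∈ Finset.range c, doubleZeta (i + 1) (c + 1 - i)) :=
      hasSum_sum fun i hi => hasSum_doubleZeta (by omega)
        (by have := Finset.mem_range.1 hi; omega)
    convert! hs.add ((Equiv.prodComm ℕ+ ℕ+).hasSum_iff.2 hD) using 1
    ext ⟨p, q⟩
    have hp : (p : ℝ) ≠ 0 := by exact_mod_cast p.pos.ne'
    have hq : (q : ℝ) ≠ 0 := by exact_mod_cast q.pos.ne'
    have hpq : (p : ℝ) + q ≠ 0 := by positivity
    simp only [doubleZetaTerm, Function.comp_apply, Equiv.prodComm_apply, Prod.swap_prod_mk,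
      pow_one]
    rw [← sum_pow_mul_pow_add (by field_simp; ring), add_comm (q : ℝ)]
  have hB : HasSum (fun x : ℕ+ × ℕ+ =>
      if x.2 ≤ x.1 then ((x.1 : ℝ)⁻¹) ^ (c + 1) * (x.2 : ℝ)⁻¹ else 0)
      (0 + (doubleZeta 1 (c + 1) + zetaPNat (c + 2))) := by
    refine HasSum.of_trichotomy ?_ ?_ ?_
    · convert! hasSum_zero (α := ℝ) (β := ℕ+ × ℕ+) using 1
      ext ⟨p, q⟩
      exact if_neg (not_le.2 (PNat.lt_add_right p q))
    · convert! hD using 1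
      ext ⟨p, q⟩
      dsimp only
      rw [if_pos (PNat.lt_add_right p q).le]
      simp [doubleZetaTerm, mul_comm]
    · convert! hasSum_zetaPNat (k := c + 2) (by omega) using 1
      ext p
      simp [pow_succ]
  have hrow (n : ℕ+) : HasSum (fun q : ℕ+ => ((n : ℝ)⁻¹) ^ c * ((q : ℝ)⁻¹ * ((n : ℝ) + q)⁻¹))
      (((n : ℝ)⁻¹) ^ (c + 1) * ∑ j ∈ Finset.range n, ((j : ℝ) + 1)⁻¹) := by
    rw [hasSum_pnat_iff_succ]
    convert! (hasSum_nat_inv_sub_inv_add n).mul_left (((n : ℝ)⁻¹) ^ (c + 1)) using 1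
    ext k
    have hn : (n : ℝ) ≠ 0 := by exact_mod_cast n.pos.ne'
    have hk : (k : ℝ) + 1 ≠ 0 := by positivity
    have hnk : (n : ℝ) + (k + 1) ≠ 0 := by positivity
    rw [Nat.succPNat_coe, pow_succ, mul_assoc, add_comm ((k : ℝ) + 1), Nat.cast_succ]
    congr 1
    field_simp
    ring
  have hrow' (n : ℕ+) : HasSum
      (fun m : ℕ+ => if m ≤ n then ((n : ℝ)⁻¹) ^ (c + 1) * (m : ℝ)⁻¹ else 0)
      (((n : ℝ)⁻¹) ^ (c + 1) * ∑ j ∈ Finset.range n, ((j : ℝ) + 1)⁻¹) := by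
    rw [hasSum_pnat_iff_succ, Finset.mul_sum]
    have h0 : ∀ k ∉ Finset.range n,
        (if k.succPNat ≤ n then ((n : ℝ)⁻¹) ^ (c + 1) * (k.succPNat : ℝ)⁻¹ else 0) = 0 := by
      intro k hk
      refine if_neg ?_
      rw [← PNat.coe_le_coe]
      exact fun h => hk (Finset.mem_range.2 h)
    have h := hasSum_sum_of_ne_finset_zero (L := SummationFilter.unconditional ℕ) h0
    convert! h using 1
    refine Finset.sum_congr rfl fun k hk => ?_
    rw [if_pos (by rw [← PNat.coe_le_coe]; exact Finset.mem_range.1 hk)]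
    simp
  have := (hA.prod_fiberwise hrow).unique (hB.prod_fiberwise hrow')
  linarith

lemma sum_range_two_mul (f : ℕ → ℝ) (t : ℕ) :
    ∑ i ∈ Finset.range (2 * t), f i =
      ∑ m ∈ Finset.range t, (f (2 * m) + f (2 * m + 1)) := by
  induction t with
  | zero => simp
  | succ t ih =>
    rw [show 2 * (t + 1) = 2 * t + 1 + 1 by ring, Finset.sum_range_succ, Finset.sum_range_succ,
      Finset.sum_range_succ, ih, add_assoc]

/-- Euler's evaluation of `ζ(1, b)` for even `b`. -/
lemma doubleZeta_one (t : ℕ) :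
    doubleZeta 1 (2 * t + 2) = (t + 1) * zetaPNat (2 * t + 3) -
      ∑ m ∈ Finset.range t, zetaPNat (2 * m + 2) * zetaPNat (2 * (t - 1 - m) + 3) := by
  have h := sum_doubleZeta (2 * t + 1) (by omega)
  rw [Finset.sum_range_succ'] at h
  have h1 : ∑ i ∈ Finset.range (2 * t), doubleZeta (i + 1 + 1) (2 * t + 1 + 1 - (i + 1)) =
      ∑ i ∈ Finset.range (2 * t), doubleZeta (2 * t + 1 + 1 - (i + 1)) (i + 1 + 1) := by
    rw [← Finset.sum_range_reflect]
    refine Finset.sum_congr rfl fun i hi => ?_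
    have := Finset.mem_range.1 hi
    congr 1 <;> omega
  have h2 : ∑ i ∈ Finset.range (2 * t), doubleZeta (i + 1 + 1) (2 * t + 1 + 1 - (i + 1)) +
      ∑ i ∈ Finset.range (2 * t), doubleZeta (2 * t + 1 + 1 - (i + 1)) (i + 1 + 1) =
      ∑ i ∈ Finset.range (2 * t), zetaPNat (i + 2) * zetaPNat (2 * t + 1 - i) -
        2 * t * zetaPNat (2 * t + 3) := by
    have hcard : 2 * t * zetaPNat (2 * t + 3) =
        ∑ _i ∈ Finset.range (2 * t), zetaPNat (2 * t + 3) := by simp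
    rw [hcard, ← Finset.sum_add_distrib, ← Finset.sum_sub_distrib]
    refine Finset.sum_congr rfl fun i hi => ?_
    have := Finset.mem_range.1 hi
    rw [← doubleZeta_stuffle (by omega) (by omega),
      show i + 2 + (2 * t + 1 - i) = 2 * t + 3 by omega,
      show 2 * t + 1 + 1 - (i + 1) = 2 * t + 1 - i by omega]
    ring
  have h3 : ∑ m ∈ Finset.range t, zetaPNat (2 * m + 1 + 2) * zetaPNat (2 * t + 1 - (2 * m + 1)) =
      ∑ m ∈ Finset.range t, zetaPNat (2 * m + 2) * zetaPNat (2 * (t - 1 - m) + 3) := by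
    rw [← Finset.sum_range_reflect]
    refine Finset.sum_congr rfl fun m hm => ?_
    have := Finset.mem_range.1 hm
    rw [mul_comm]
    congr 2; omega
  have h4 : ∑ m ∈ Finset.range t, zetaPNat (2 * m + 2) * zetaPNat (2 * t + 1 - 2 * m) =
      ∑ m ∈ Finset.range t, zetaPNat (2 * m + 2) * zetaPNat (2 * (t - 1 - m) + 3) := by
    refine Finset.sum_congr rfl fun m hm => ?_
    have := Finset.mem_range.1 hm
    congr 2; omega
  rw [sum_range_two_mul (fun i => zetaPNat (i + 2) * _), Finset.sum_add_distrib, h3, h4, h1] at h2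
  rw [h1, zero_add, Nat.sub_zero] at h
  linarith


lemma MZV_singleton (k : ℕ) : MZV [k] = zetaPNat k := by
  let e : ℕ+ ≃ {f : Fin ([k] : List ℕ).length → ℕ+ // StrictMono f} :=
    { toFun := fun n => ⟨fun _ => n, fun i j h => absurd h (by have := i.2; have := j.2; simp at *)⟩
      invFun := fun f => f.1 0
      left_inv := fun n => rfl
      right_inv := fun f => by
        ext i
        have : i = 0 := Subsingleton.elim (α := Fin 1) _ _
        rw [this] }
  rw [MZV, zetaPNat, ← e.tsum_eq]
  refine tsum_congr fun n => ?_
  simp [e]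

lemma MZV_pair (a b : ℕ) : MZV [a, b] = doubleZeta a b := by
  let e : ℕ+ × ℕ+ ≃ {f : Fin ([a, b] : List ℕ).length → ℕ+ // StrictMono f} :=
    { toFun := fun x => ⟨(![x.1, x.1 + x.2] : Fin 2 → ℕ+), by
        rw [show StrictMono (![x.1, x.1 + x.2] : Fin 2 → ℕ+) ↔ _ from Fin.strictMono_iff_lt_succ]
        intro i
        fin_cases i
        exact PNat.lt_add_right _ _⟩
      invFun := fun f => ((f.1 : Fin 2 → ℕ+) 0, (f.1 : Fin 2 → ℕ+) 1 - (f.1 : Fin 2 → ℕ+) 0)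
      left_inv := fun x => by
        refine Prod.ext rfl ?_
        exact (show x.1 + x.2 - x.1 = x.2 by rw [add_comm, PNat.add_sub])
      right_inv := fun f => by
        have h : (f.1 : Fin 2 → ℕ+) 0 < (f.1 : Fin 2 → ℕ+) 1 := f.2 (show (0 : Fin 2) < 1 by decide)
        refine Subtype.ext (funext fun (i : Fin 2) => ?_)
        fin_cases i
        · rfl
        · exact PNat.add_sub_of_lt h }
  rw [MZV, doubleZeta, ← e.tsum_eq]
  refine tsum_congr fun x => ?_
  rw [show ∏ i, 1 / (((e x).1 i : ℕ) : ℝ) ^ ([a, b] : List ℕ).get i = _ from Fin.prod_univ_two _]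
  simp [e, doubleZetaTerm]

lemma zetaStarOf_nil (Z : List ℕ → ℝ) : zetaStarOf Z [] = Z [] := by
  simp [zetaStarOf, contractions]

lemma zetaStarOf_singleton (Z : List ℕ → ℝ) (k : ℕ) : zetaStarOf Z [k] = Z [k] := by
  simp [zetaStarOf, contractions]

lemma zetaA_nil (Z : List ℕ → ℝ) (a : ℕ) : zetaA Z a [] = if a = 0 then Z [] else 0 := by
  rcases a with _ | a
  · simp [zetaA]
  · simp [zetaA]

lemma zetaA_singleton (Z : List ℕ → ℝ) (a : ℕ) {l : ℕ} (hl : 1 ≤ l) :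
    zetaA Z a [l] = (-1) ^ a * (Z [l + a] * ((l + a - 1).choose a : ℝ)) := by
  rw [zetaA]
  congr 1
  rw [show l + a - 1 = l - 1 + a by omega]
  have hsum (f : Fin ([l] : List ℕ).length → ℕ) : ∑ i, f i = f 0 :=
    Fin.sum_univ_one (M := ℕ) f
  refine (Finset.sum_eq_single_of_mem (fun _ => a) ?_ fun f hf hne => ?_).trans (by simp)
  · rw [Finset.mem_filter, Fintype.mem_piFinset, hsum]
    exact ⟨fun _ => Finset.mem_range.2 a.lt_succ_self, rfl⟩
  · refine absurd (funext fun i => ?_) hne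
    rw [Subsingleton.elim (α := Fin 1) i 0]
    exact (hsum f).symm.trans (Finset.mem_filter.1 hf).2

/-- The sum `∑_m (-1)^m (2π)^{2m} B_{2m} / (2 (2m)!) F(k - 2m)`. -/
noncomputable def bernoulliSum (k : ℕ) (F : ℕ → ℝ) : ℝ :=
  ∑ m ∈ Finset.range (k / 2 + 1), (-1 : ℝ) ^ m * ((2 * π) ^ (2 * m) *
    ((bernoulli (2 * m) : ℚ) : ℝ) / (2 * Nat.factorial (2 * m))) * F (k - 2 * m)

lemma bernoulliSum_eq (k : ℕ) (F : ℕ → ℝ) :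
    bernoulliSum k F =
      F k / 2 - ∑ m ∈ Finset.range (k / 2), zetaPNat (2 * m + 2) * F (k - (2 * m + 2)) := by
  rw [bernoulliSum, Finset.sum_range_succ', sub_eq_add_neg, add_comm (F k / 2),
    ← Finset.sum_neg_distrib]
  congr 1
  · refine Finset.sum_congr rfl fun m _ => ?_
    rw [zetaPNat_two_mul (Nat.succ_ne_zero m), neg_mul]
    rfl
  · simp; ring

lemma sum_range_succ_eq_sum_even {h : ℕ → ℝ} (h0 : ∀ i, ¬ Even i → h i = 0) (a : ℕ) :
    ∑ i ∈ Finset.range a, h (i + 1) = ∑ m ∈ Finset.range (a / 2), h (2 * m + 2) := by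
  induction a with
  | zero => simp
  | succ a ih =>
    rw [Finset.sum_range_succ, ih]
    rcases Nat.even_or_odd' a with ⟨t, rfl | rfl⟩
    · rw [h0 (2 * t + 1) (by simp), show (2 * t + 1) / 2 = 2 * t / 2 by omega, add_zero]
    · rw [show (2 * t + 1 + 1) / 2 = (2 * t + 1) / 2 + 1 by omega, Finset.sum_range_succ,
        show 2 * ((2 * t + 1) / 2) = 2 * t by omega]

lemma sum_mul_zetaInt (a : ℕ) (F : ℕ → ℝ) :
    ∑ s ∈ Finset.range a, F s * zetaInt (a - s) = F a - 2 * bernoulliSum a F := by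
  have h := sum_range_succ_eq_sum_even (h := fun i => F (a - i) * zetaInt i)
    (fun i hi => by simp [zetaInt, hi]) a
  rw [← Finset.sum_range_reflect] at h
  have h1 : ∑ s ∈ Finset.range a, F s * zetaInt (a - s) =
      ∑ m ∈ Finset.range (a / 2), F (a - (2 * m + 2)) * zetaInt (2 * m + 2) := by
    rw [← h]
    refine Finset.sum_congr rfl fun s hs => ?_
    have := Finset.mem_range.1 hs
    rw [show a - 1 - s + 1 = a - s by omega, show a - (a - s) = s by omega]
  have h2 (m : ℕ) : zetaInt (2 * m + 2) = 2 * zetaPNat (2 * m + 2) := if_pos (by simp [Nat.even_add])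
  rw [h1, bernoulliSum_eq]
  simp only [h2, mul_sub, Finset.mul_sum]
  rw [mul_div_cancel₀ _ two_ne_zero, sub_sub_cancel]
  exact Finset.sum_congr rfl fun m _ => by ring

lemma doubleZeta_bernoulli_relation {a b : ℕ} (ha : 2 ≤ a) (hb : 2 ≤ b) :
    (-1) ^ a * doubleZeta a b + (-1) ^ b * doubleZeta b a + zetaPNat a * zetaPNat b =
      -2 * (bernoulliSum a (fun s => zetaPNat (b + s) * ((b + s - 1).choose s : ℝ)) +
        bernoulliSum b (fun s => zetaPNat (a + s) * ((a + s - 1).choose s : ℝ))) := by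
  obtain ⟨a, rfl⟩ : ∃ c, a = c + 1 := ⟨a - 1, by omega⟩
  obtain ⟨b, rfl⟩ : ∃ c, b = c + 1 := ⟨b - 1, by omega⟩
  rw [doubleZeta_parity_relation (by omega) (by omega)]
  have h1 := sum_mul_zetaInt (a + 1)
    (fun s => zetaPNat (b + 1 + s) * ((b + 1 + s - 1).choose s : ℝ))
  have h2 := sum_mul_zetaInt (b + 1)
    (fun s => zetaPNat (a + 1 + s) * ((a + 1 + s - 1).choose s : ℝ))
  have e1 : (a + b + 1).choose a = (a + b + 1).choose (b + 1) :=
    Nat.choose_symm_of_eq_add (by omega)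
  have e2 : (a + b + 1).choose b = (a + b + 1).choose (a + 1) :=
    Nat.choose_symm_of_eq_add (by omega)
  simp only [show b + 1 + (a + 1) = a + b + 2 by omega,
    show a + 1 + (b + 1) = a + b + 2 by omega, show a + b + 2 - 1 = a + b + 1 by omega] at h1 h2
  rw [e1, e2]
  have c1 : ∑ s ∈ Finset.range (a + 1),
      ((b + 1 + s - 1).choose s : ℝ) * zetaInt (a + 1 - s) * zetaPNat (b + 1 + s) = _ :=
    (Finset.sum_congr rfl fun s _ => by ring).trans h1
  have c2 : ∑ s ∈ Finset.range (b + 1),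
      ((a + 1 + s - 1).choose s : ℝ) * zetaInt (b + 1 - s) * zetaPNat (a + 1 + s) = _ :=
    (Finset.sum_congr rfl fun s _ => by ring).trans h2
  rw [c1, c2]
  ring


lemma doubleZeta_parity {k₁ k₂ : ℕ} (h₁ : 2 ≤ k₁) (h₂ : 2 ≤ k₂) (hodd : Odd (k₁ + k₂)) :
    doubleZeta k₁ k₂ = -zetaPNat (k₁ + k₂) / 2 +
      (if Even k₂ then zetaPNat k₂ * zetaPNat k₁ else 0) - (-1) ^ k₁ *
        (bernoulliSum k₁ (fun s => zetaPNat (k₂ + s) * ((k₂ + s - 1).choose s : ℝ)) +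
        bernoulliSum k₂ (fun s => zetaPNat (k₁ + s) * ((k₁ + s - 1).choose s : ℝ))) := by
  have h := doubleZeta_bernoulli_relation h₁ h₂
  have hs := doubleZeta_stuffle h₁ h₂
  rcases Nat.even_or_odd k₂ with he | ho
  · have ho : Odd k₁ := by grind
    rw [if_pos he, ho.neg_one_pow]
    rw [ho.neg_one_pow, he.neg_one_pow] at h
    linarith
  · have he : Even k₁ := by grind
    rw [if_neg (Nat.not_even_iff_odd.2 ho), he.neg_one_pow]
    rw [ho.neg_one_pow, he.neg_one_pow] at h
    linarith

lemma IsStuffleReg.singleton {Z : List ℕ → ℝ} (hZ : IsStuffleReg Z) {k : ℕ} (hk : 2 ≤ k) :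
    Z [k] = zetaPNat k := by
  rw [hZ.conv [k] (by simp; omega) (by simpa using hk), MZV_singleton]

lemma bernoulliSum_congr {k : ℕ} {F G : ℕ → ℝ} (h : ∀ s ≤ k, F s = G s) :
    bernoulliSum k F = bernoulliSum k G :=
  Finset.sum_congr rfl fun m _ => by rw [h _ (Nat.sub_le _ _)]

/-- The parity formula for double zeta values, where the possible occurrence of the divergent
`ζ(1)` is replaced by an arbitrary value. -/
lemma IsStuffleReg.doubleZeta_parity {Z : List ℕ → ℝ} (hZ : IsStuffleReg Z) {k₁ k₂ : ℕ}
    (h₁ : 1 ≤ k₁) (h₂ : 2 ≤ k₂) (hodd : Odd (k₁ + k₂)) :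
    doubleZeta k₁ k₂ = -zetaPNat (k₁ + k₂) / 2 +
      (if Even k₂ then zetaPNat k₂ * Z [k₁] else 0) - (-1) ^ k₁ *
        (bernoulliSum k₁ (fun s => Z [k₂ + s] * ((k₂ + s - 1).choose s : ℝ)) +
        bernoulliSum k₂ (fun s => Z [k₁ + s] * ((k₁ + s - 1).choose s : ℝ))) := by
  rcases Nat.lt_or_ge 1 k₁ with h | h
  · rw [bernoulliSum_congr (F := fun s => Z [k₂ + s] * _) fun s _ => by
        rw [hZ.singleton (show 2 ≤ k₂ + s by omega)],
      bernoulliSum_congr (F := fun s => Z [k₁ + s] * _) fun s _ => by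
        rw [hZ.singleton (show 2 ≤ k₁ + s by omega)],
      hZ.singleton h]
    exact _root_.doubleZeta_parity h h₂ hodd
  · obtain rfl : k₁ = 1 := by omega
    have he : Even k₂ := by grind
    obtain ⟨t, rfl⟩ : ∃ t, k₂ = 2 * t + 2 := ⟨k₂ / 2 - 1, by grind⟩
    rw [doubleZeta_one, if_pos he, bernoulliSum_eq, bernoulliSum_eq,
      show (2 * t + 2) / 2 = t + 1 by omega, Finset.sum_range_succ,
      hZ.singleton (show 2 ≤ 2 * t + 2 + 1 by omega),
      hZ.singleton (show 2 ≤ 1 + (2 * t + 2) by omega)]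
    have hsum : ∑ m ∈ Finset.range t, zetaPNat (2 * m + 2) *
        (Z [1 + (2 * t + 2 - (2 * m + 2))] *
          ((1 + (2 * t + 2 - (2 * m + 2)) - 1).choose (2 * t + 2 - (2 * m + 2)) : ℝ)) =
        ∑ m ∈ Finset.range t, zetaPNat (2 * m + 2) * zetaPNat (2 * (t - 1 - m) + 3) := by
      refine Finset.sum_congr rfl fun m hm => ?_
      have := Finset.mem_range.1 hm
      rw [add_tsub_cancel_left, Nat.choose_self, Nat.cast_one, mul_one,
        hZ.singleton (show 2 ≤ 1 + (2 * t + 2 - (2 * m + 2)) by omega)]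
      congr 2; omega
    rw [hsum, show 1 + (2 * t + 2) = 2 * t + 3 by ring, show 2 * t + 2 + 1 = 2 * t + 3 by ring]
    simp
    ring

lemma sum_range_mul_ite_eq_zero_mul (n : ℕ) (A B : ℕ → ℝ) :
    ∑ a ∈ Finset.range (n + 1), (A a * if a = 0 then 1 else 0) * B a = A 0 * B 0 := by
  simp

lemma sum_range_mul_ite_sub_eq_zero (n : ℕ) (A : ℕ → ℝ) :
    ∑ a ∈ Finset.range (n + 1), A a * (if n - a = 0 then 1 else 0) = A n := by
  rw [Finset.sum_eq_single_of_mem n (by simp)]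
  · simp
  · intro a ha hne
    have := Finset.mem_range.1 ha
    rw [if_neg (by omega), mul_zero]

lemma neg_one_pow_sub_two_mul {k m : ℕ} (hm : m ∈ Finset.range (k / 2 + 1)) :
    (-1 : ℝ) ^ (k - 2 * m) = (-1) ^ k := by
  have := Finset.mem_range.1 hm
  conv_rhs => rw [show k = k - 2 * m + 2 * m by omega, pow_add, pow_mul]
  simp

lemma neg_one_pow_mul_self (k : ℕ) : (-1 : ℝ) ^ k * (-1) ^ k = 1 := by
  rw [← mul_pow]; simp

lemma bernoulliSum_ite (k : ℕ) (hk : 2 ≤ k) (c : ℝ) :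
    bernoulliSum k (fun s => if s = 0 then c else 0) =
      -(if Even k then zetaPNat k * c else 0) := by
  rw [bernoulliSum_eq, if_neg (by omega), zero_div, zero_sub, neg_inj]
  rcases Nat.even_or_odd' k with ⟨t, rfl | rfl⟩
  · rw [if_pos (by simp), Finset.sum_eq_single_of_mem (t - 1) (Finset.mem_range.2 (by omega))]
    · rw [show 2 * (t - 1) + 2 = 2 * t by omega, Nat.sub_self, if_pos rfl]
    · intro m hm hne
      have := Finset.mem_range.1 hm
      rw [if_neg (by omega), mul_zero]
  · rw [if_neg (by simp)]
    refine Finset.sum_eq_zero fun m hm => ?_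
    have := Finset.mem_range.1 hm
    rw [if_neg (by omega), mul_zero]


/-- Depth-2 case of the explicit parity formula: for `k₁ ≥ 1`, `k₂ ≥ 2` with `k₁+k₂` odd,
`ζ(k₁,k₂) = (ζ(k₁,k₂) − ζ(k₁,k₂) − ζ(k₁+k₂))/2 − ∑_{0≤i<j≤2} ∑_{a+2m+b=k_j}
(-1)^{m+i+b+k₁+⋯+k_j} (2π)^{2m} B_{2m}/(2(2m)!) ζ^{⋆,*}(k₁,…,k_i) ζ_a^*(…) ζ_b(…)`,
where the inner lists are as in Hirose's theorem specialized to `d = 2`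
(here `ζ^⋆(k₁,k₂)` has been expanded as `ζ(k₁,k₂) + ζ(k₁+k₂)`). -/
theorem explicit_parity_depth_two (Z : List ℕ → ℝ) (hZ : IsStuffleReg Z)
    (k₁ k₂ : ℕ) (h₁ : 1 ≤ k₁) (h₂ : 2 ≤ k₂) (hodd : Odd (k₁ + k₂)) :
    MZV [k₁, k₂] = (MZV [k₁, k₂] - MZV [k₁, k₂] - MZV [k₁ + k₂]) / 2 -
      ∑ j ∈ Finset.Icc 1 ([k₁, k₂] : List ℕ).length, ∑ i ∈ Finset.range j,
        ∑ m ∈ Finset.range (([k₁, k₂] : List ℕ).getD (j - 1) 0 / 2 + 1),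
          ∑ a ∈ Finset.range (([k₁, k₂] : List ℕ).getD (j - 1) 0 - 2 * m + 1),
            (-1 : ℝ) ^ (m + i + (([k₁, k₂] : List ℕ).getD (j - 1) 0 - 2 * m - a) +
                (([k₁, k₂] : List ℕ).take j).sum) *
              ((2 * π) ^ (2 * m) * ((bernoulli (2 * m) : ℚ) : ℝ) /
                (2 * Nat.factorial (2 * m))) *
              zetaStarOf Z (([k₁, k₂] : List ℕ).take i) *
              zetaA Z a (((([k₁, k₂] : List ℕ).take (j - 1)).drop i).reverse) *
              zetaA Z (([k₁, k₂] : List ℕ).getD (j - 1) 0 - 2 * m - a)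
                (([k₁, k₂] : List ℕ).drop j) := by
  have main (S₁ S₂ S₃ : ℝ)
      (e₁ : S₁ = (-1) ^ k₁ *
        bernoulliSum k₁ (fun s => Z [k₂ + s] * ((k₂ + s - 1).choose s : ℝ)))
      (e₂ : S₂ = (-1) ^ k₁ *
        bernoulliSum k₂ (fun s => Z [k₁ + s] * ((k₁ + s - 1).choose s : ℝ)))
      (e₃ : S₃ = bernoulliSum k₂ (fun s => if s = 0 then Z [k₁] else 0)) :
      MZV [k₁, k₂] = (MZV [k₁, k₂] - MZV [k₁, k₂] - MZV [k₁ + k₂]) / 2 - (S₁ + (S₂ + S₃)) := by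
    rw [e₁, e₂, e₃, bernoulliSum_ite k₂ h₂, sub_self, MZV_singleton, MZV_pair,
      hZ.doubleZeta_parity h₁ h₂ hodd]
    ring
  rw [show Finset.Icc 1 ([k₁, k₂] : List ℕ).length = {1, 2} from rfl,
    Finset.sum_pair (by norm_num), Finset.sum_range_one,
    show Finset.range 2 = {0, 1} from rfl, Finset.sum_pair zero_ne_one]
  simp only [Nat.sub_self, Nat.add_one_sub_one, List.getD_cons_zero, List.getD_cons_succ,
    List.take_zero, List.drop_zero, List.take_succ_cons, List.drop_succ_cons, List.reverse_nil,
    List.reverse_cons, List.drop_nil, List.nil_append, zetaStarOf_nil,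
    show List.take 1 [k₁, k₂] = [k₁] from rfl, show List.drop 1 [k₁] = [] from rfl,
    zetaStarOf_singleton, zetaA_nil, hZ.empty, zetaA_singleton Z _ h₁,
    zetaA_singleton Z _ (one_le_two.trans h₂), List.sum_cons, List.sum_nil,
    sum_range_mul_ite_sub_eq_zero, sum_range_mul_ite_eq_zero_mul]
  have hsign : (-1 : ℝ) ^ (k₁ + k₂) = -1 := hodd.neg_one_pow
  rw [pow_add] at hsign
  refine main _ _ _ ?_ ?_ ?_ <;> rw [bernoulliSum] <;> (try rw [Finset.mul_sum]) <;>
    refine Finset.sum_congr rfl fun m hm => ?_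
  · simp only [pow_add, neg_one_pow_sub_two_mul hm, Nat.sub_zero, pow_zero]
    generalize (2 * π) ^ (2 * m) * ((bernoulli (2 * m) : ℚ) : ℝ) /
      (2 * (Nat.factorial (2 * m) : ℝ)) = G
    generalize Z [k₂ + (k₁ - 2 * m)] = x
    generalize (((k₂ + (k₁ - 2 * m) - 1).choose (k₁ - 2 * m) : ℕ) : ℝ) = c
    linear_combination G * x * c * (-1) ^ m * (-1) ^ k₁ * neg_one_pow_mul_self k₁
  · simp only [pow_add, neg_one_pow_sub_two_mul hm, pow_zero]
    generalize (2 * π) ^ (2 * m) * ((bernoulli (2 * m) : ℚ) : ℝ) /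
      (2 * (Nat.factorial (2 * m) : ℝ)) = G
    generalize Z [k₁ + (k₂ - 2 * m)] = x
    generalize (((k₁ + (k₂ - 2 * m) - 1).choose (k₂ - 2 * m) : ℕ) : ℝ) = c
    linear_combination G * x * c * (-1) ^ m * (-1) ^ k₁ * neg_one_pow_mul_self k₂
  · simp only [pow_add, pow_zero, pow_one]
    generalize (2 * π) ^ (2 * m) * ((bernoulli (2 * m) : ℚ) : ℝ) /
      (2 * (Nat.factorial (2 * m) : ℝ)) = G
    split_ifs
    · linear_combination -(G * Z [k₁] * (-1) ^ m) * hsign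
    · simp
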